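/- arXiv:2302.09060 — 8 statements merged into one kernel-verified Lean document; each statement's English description precedes it below -/
import Mathlib

section
/- Let s be an n-simplex in n-dimensional Euclidean space (n ≥ 1). If a closed ball of radius r ≥ 0 (centered at any point) is contained in the convex hull of the vertices of s, then r ≤ (circumradius of s)/n. In particular, the inradius of an n-simplex is at least n times smaller than its circumradius. -/
/-- The inradius of an `n`-simplex is at least `n` times smaller than its circumradius:
if a closed ball of radius `r ≥ 0` is contained in the convex hull of the vertices of an
`n`-simplex `s` in `n`-dimensional Euclidean space (`n ≥ 1`), then `r ≤ circumradius / n`. -/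
theorem simplex_inradius_le_circumradius_div
    (n : ℕ) (hn : 1 ≤ n)
    (s : Affine.Simplex ℝ (EuclideanSpace ℝ (Fin n)) n)
    (r : ℝ) (hr : 0 ≤ r) (x : EuclideanSpace ℝ (Fin n))
    (hball : Metric.closedBall x r ⊆ convexHull ℝ (Set.range s.points)) :
    r ≤ s.circumradius / n := by
  have htop : affineSpan ℝ (Set.range s.points) = ⊤ := by
    rw [s.independent.affineSpan_eq_top_iff_card_eq_finrank_add_one]
    simp
  let b : AffineBasis (Fin (n + 1)) ℝ (EuclideanSpace ℝ (Fin n)) :=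
    ⟨s.points, s.independent, htop⟩
  obtain ⟨m, rfl⟩ : ∃ m, n = m + 1 := ⟨n - 1, by omega⟩
  have hR : 0 < s.circumradius := s.circumradius_pos
  set R := s.circumradius with hRdef
  set c := s.circumcenter with hc
  have hw : ∀ i, ‖s.points i - c‖ = R := fun i => by
    rw [← dist_eq_norm]; exact s.dist_circumcenter_eq_circumradius i
  have hlin : ∀ i v, (b.coord i).linear v = b.coord i v - b.coord i 0 := fun i v => by
    have := (b.coord i).linearMap_vsub v 0
    simpa using this
  have hid : ∑ i, (b.coord i).linear.smulRight (s.points i - c) = LinearMap.id := by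
    ext1 v
    have h1 : ∑ i, b.coord i v • s.points i = v := b.linear_combination_coord_eq_self v
    have h0 : ∑ i, b.coord i 0 • s.points i = 0 := b.linear_combination_coord_eq_self 0
    simp only [LinearMap.sum_apply, LinearMap.smulRight_apply, hlin, sub_smul, smul_sub,
      Finset.sum_sub_distrib, h1, h0, ← Finset.sum_smul, b.sum_coord_apply_eq_one]
    simp
  have htr : ∑ i, (b.coord i).linear (s.points i - c) = ((m + 1 : ℕ) : ℝ) := by
    have := congrArg (LinearMap.trace ℝ _) hid
    rw [map_sum, LinearMap.trace_id] at this
    simpa [LinearMap.trace_smulRight] using this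
  have hpos : ∀ i, r / R * (b.coord i).linear (s.points i - c) ≤ b.coord i x := fun i => by
    have hy : (-(r / R)) • (s.points i - c) +ᵥ x ∈ Metric.closedBall x r := by
      rw [Metric.mem_closedBall, dist_vadd_left, norm_smul, hw, norm_neg, Real.norm_of_nonneg (by positivity)]
      exact (div_mul_cancel₀ r hR.ne').le
    have hy2 := hball hy
    have h3 : (-(r / R)) • (s.points i - c) +ᵥ x ∈ convexHull ℝ (Set.range b) := hy2
    rw [b.convexHull_eq_nonneg_coord] at h3
    have h4 := h3 i
    rw [AffineMap.map_vadd, map_smul] at h4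
    simp only [smul_eq_mul, vadd_eq_add] at h4
    linarith
  have hsum := Finset.sum_le_sum fun i (_ : i ∈ Finset.univ) => hpos i
  rw [← Finset.mul_sum, htr, b.sum_coord_apply_eq_one] at hsum
  rw [le_div_iff₀ (by positivity)]
  rwa [div_mul_eq_mul_div, div_le_one hR] at hsum
end

section
/- Let n₁, n₂, n₃ be unit vectors in ℝ² and let α₁, α₂, α₃ ≥ 0 with α₁ + α₂ + α₃ = 1. Define the compatible region m = {2·Σᵢ qᵢ αᵢ nᵢ : 0 ≤ qᵢ ≤ 1, Σᵢ qᵢ αᵢ = 1/2} ⊆ ℝ². If the closed ball of radius r ≥ 0 centered at the origin is contained in m, then r ≤ 1/2. (Upper bound R^p(3) ≤ 1/2 on the three-outcome planar compatibility radius.) -/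
/-- The compatible region of a three-outcome planar POVM with rank-one effect directions
`n i` and weights `α i`. -/
def compatRegion {d k : ℕ} (α : Fin k → ℝ) (n : Fin k → EuclideanSpace ℝ (Fin d)) :
    Set (EuclideanSpace ℝ (Fin d)) :=
  {x | ∃ q : Fin k → ℝ, (∀ i, 0 ≤ q i ∧ q i ≤ 1) ∧
    (∑ i, q i * α i = 1 / 2) ∧ x = ∑ i, (2 * (q i * α i)) • n i}

/-- Support-function bound obtained by testing a direction and its opposite. -/
theorem key_bound (n : Fin 3 → EuclideanSpace ℝ (Fin 2))
    (α : Fin 3 → ℝ) (hα : ∀ i, 0 ≤ α i)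
    (r : ℝ) (hr : 0 ≤ r)
    (hball : Metric.closedBall (0 : EuclideanSpace ℝ (Fin 2)) r ⊆ compatRegion α n)
    (p s c : ℝ) :
    r * √(p ^ 2 + s ^ 2) ≤ ∑ i, α i * |n i 0 * p + n i 1 * s - c| := by
  have hpos : 0 ≤ p ^ 2 + s ^ 2 := by positivity
  obtain hL | hL := (Real.sqrt_nonneg (p ^ 2 + s ^ 2)).eq_or_lt
  · rw [← hL, mul_zero]
    exact Finset.sum_nonneg fun i _ => mul_nonneg (hα i) (abs_nonneg _)
  set L := √(p ^ 2 + s ^ 2) with hLdef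
  have hLsq : L ^ 2 = p ^ 2 + s ^ 2 := Real.sq_sqrt hpos
  have main : ∀ e : ℝ, e ^ 2 = 1 → (!₂[e * r / L * p, e * r / L * s] :
      EuclideanSpace ℝ (Fin 2)) ∈ Metric.closedBall (0 : EuclideanSpace ℝ (Fin 2)) r := by
    intro e he
    rw [mem_closedBall_zero_iff, EuclideanSpace.norm_eq]
    apply Real.sqrt_le_iff.2 ⟨hr, _⟩
    simp only [Fin.sum_univ_two, Real.norm_eq_abs, sq_abs]
    simp
    apply le_of_eq
    field_simp
    rw [he, hLsq]
    ring
  obtain ⟨q, hq, hqs, hqx⟩ := hball (main 1 (by norm_num))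
  obtain ⟨t, ht, hts, htx⟩ := hball (main (-1) (by norm_num))
  have h0 := congrArg (fun v : EuclideanSpace ℝ (Fin 2) => v 0 * p + v 1 * s) hqx
  have h1 := congrArg (fun v : EuclideanSpace ℝ (Fin 2) => v 0 * p + v 1 * s) htx
  simp [Fin.sum_univ_three] at h0 h1
  have e0 : r / L * p * p + r / L * s * s = r * L := by
    field_simp; rw [hLsq]
  have e1 : -r / L * p * p + -r / L * s * s = -(r * L) := by
    rw [← e0]; ring
  have hb : ∀ i, (q i - t i) * α i * (n i 0 * p + n i 1 * s - c)
      ≤ α i * |n i 0 * p + n i 1 * s - c| := by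
    intro i
    have h1 : |q i - t i| ≤ 1 := by
      rw [abs_le]; constructor <;> linarith [(hq i).1, (hq i).2, (ht i).1, (ht i).2]
    calc _ ≤ |(q i - t i) * α i * (n i 0 * p + n i 1 * s - c)| := le_abs_self _
      _ = |q i - t i| * (α i * |n i 0 * p + n i 1 * s - c|) := by
        rw [abs_mul, abs_mul, abs_of_nonneg (hα i)]; ring
      _ ≤ 1 * (α i * |n i 0 * p + n i 1 * s - c|) :=
        mul_le_mul_of_nonneg_right h1 (mul_nonneg (hα i) (abs_nonneg _))
      _ = _ := one_mul _
  refine le_trans (le_of_eq ?_) (Finset.sum_le_sum fun i _ => hb i)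
  rw [Fin.sum_univ_three] at hqs hts ⊢
  linear_combination (1/2) * h0 - (1/2) * h1 - (1/2) * e0 + (1/2) * e1 + c * hqs - c * hts

theorem tri_ineq (a b c D : ℝ) (ha : 0 ≤ a) (hb : 0 ≤ b) (hc : 0 ≤ c)
    (hD : 4 * D ^ 2 = a ^ 2 * b ^ 2 * c ^ 2) (hS : a ^ 2 + b ^ 2 + c ^ 2 ≤ 9) :
    2 * |D| ≤ a + b + c := by
  have h : 2 * |D| = a * b * c := by
    have : (2 * |D|) ^ 2 = (a * b * c) ^ 2 := by rw [mul_pow, sq_abs]; linarith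
    exact (pow_left_inj₀ (by positivity) (by positivity) two_ne_zero).1 this
  rw [h]
  have h1 : 9 * (a * b * c) ≤ (a + b + c) * (a ^ 2 + b ^ 2 + c ^ 2) := by
    nlinarith [mul_nonneg ha (sq_nonneg (b - c)), mul_nonneg hb (sq_nonneg (a - c)),
      mul_nonneg hc (sq_nonneg (a - b)), mul_nonneg (add_nonneg (add_nonneg ha hb) hc)
      (add_nonneg (add_nonneg (sq_nonneg (a - b)) (sq_nonneg (b - c))) (sq_nonneg (a - c)))]
  have h2 : (a + b + c) * (a ^ 2 + b ^ 2 + c ^ 2) ≤ (a + b + c) * 9 :=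
    mul_le_mul_of_nonneg_left hS (by positivity)
  linarith

theorem area_identity (x y z u v w : ℝ) (h1 : x ^ 2 + u ^ 2 = 1) (h2 : y ^ 2 + v ^ 2 = 1)
    (h3 : z ^ 2 + w ^ 2 = 1) :
    4 * (x * (v - w) + y * (w - u) + z * (u - v)) ^ 2 =
      ((v - w) ^ 2 + (z - y) ^ 2) * ((w - u) ^ 2 + (x - z) ^ 2)
        * ((u - v) ^ 2 + (y - x) ^ 2) := by
  have hu : u ^ 2 = 1 - x ^ 2 := by linarith
  have hv : v ^ 2 = 1 - y ^ 2 := by linarith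
  have hw : w ^ 2 = 1 - z ^ 2 := by linarith
  have e1 : (v - w) ^ 2 + (z - y) ^ 2 = 2 - 2 * (v * w + y * z) := by
    linear_combination h2 + h3
  have e2 : (w - u) ^ 2 + (x - z) ^ 2 = 2 - 2 * (u * w + x * z) := by
    linear_combination h1 + h3
  have e3 : (u - v) ^ 2 + (y - x) ^ 2 = 2 - 2 * (u * v + x * y) := by
    linear_combination h1 + h2
  rw [e1, e2, e3]
  ring_nf
  simp only [hu, hv, hw]
  ring

set_option maxHeartbeats 1000000 in
/-- Upper bound `R^p(3) ≤ 1/2` on the three-outcome planar compatibility radius: if the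
closed ball of radius `r ≥ 0` about the origin is contained in the compatible region of a
three-outcome planar POVM, then `r ≤ 1/2`. -/
theorem planar_three_outcome_radius_le_half
    (n : Fin 3 → EuclideanSpace ℝ (Fin 2)) (hn : ∀ i, ‖n i‖ = 1)
    (α : Fin 3 → ℝ) (hα : ∀ i, 0 ≤ α i) (hαsum : ∑ i, α i = 1)
    (r : ℝ) (hr : 0 ≤ r)
    (hball : Metric.closedBall (0 : EuclideanSpace ℝ (Fin 2)) r ⊆ compatRegion α n) :
    r ≤ 1 / 2 := by
  have K := key_bound n α hα r hr hball
  have hn' : ∀ i, n i 0 ^ 2 + n i 1 ^ 2 = 1 := by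
    intro i
    have := EuclideanSpace.norm_sq_eq (n i)
    rw [hn i] at this
    simpa [Fin.sum_univ_two] using this.symm
  simp only [Fin.sum_univ_three] at K hαsum
  have h1 := hn' 0
  have h2 := hn' 1
  have h3 := hn' 2
  generalize n 0 0 = x at *
  generalize n 0 1 = u at *
  generalize n 1 0 = y at *
  generalize n 1 1 = v at *
  generalize n 2 0 = z at *
  generalize n 2 1 = w at *
  obtain ⟨D, hD⟩ : ∃ D, D = x * (v - w) + y * (w - u) + z * (u - v) := ⟨_, rfl⟩
  have ka := K (v - w) (z - y) (y * (v - w) + v * (z - y))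
  have kb := K (w - u) (x - z) (z * (w - u) + w * (x - z))
  have kc := K (u - v) (y - x) (x * (u - v) + u * (y - x))
  rw [show x * (v - w) + u * (z - y) - (y * (v - w) + v * (z - y)) = D by rw [hD]; ring,
    show y * (v - w) + v * (z - y) - (y * (v - w) + v * (z - y)) = 0 by ring,
    show z * (v - w) + w * (z - y) - (y * (v - w) + v * (z - y)) = 0 by ring] at ka
  rw [show x * (w - u) + u * (x - z) - (z * (w - u) + w * (x - z)) = 0 by ring,
    show y * (w - u) + v * (x - z) - (z * (w - u) + w * (x - z)) = D by rw [hD]; ring,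
    show z * (w - u) + w * (x - z) - (z * (w - u) + w * (x - z)) = 0 by ring] at kb
  rw [show x * (u - v) + u * (y - x) - (x * (u - v) + u * (y - x)) = 0 by ring,
    show y * (u - v) + v * (y - x) - (x * (u - v) + u * (y - x)) = 0 by ring,
    show z * (u - v) + w * (y - x) - (x * (u - v) + u * (y - x)) = D by rw [hD]; ring] at kc
  simp only [abs_zero, mul_zero, add_zero, zero_add] at ka kb kc
  have A := area_identity x y z u v w h1 h2 h3
  rw [← hD] at A
  have sa := Real.sq_sqrt (show 0 ≤ (v - w) ^ 2 + (z - y) ^ 2 by positivity)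
  have sb := Real.sq_sqrt (show 0 ≤ (w - u) ^ 2 + (x - z) ^ 2 by positivity)
  have sc := Real.sq_sqrt (show 0 ≤ (u - v) ^ 2 + (y - x) ^ 2 by positivity)
  have pa := Real.sqrt_nonneg ((v - w) ^ 2 + (z - y) ^ 2)
  have pb := Real.sqrt_nonneg ((w - u) ^ 2 + (x - z) ^ 2)
  have pc := Real.sqrt_nonneg ((u - v) ^ 2 + (y - x) ^ 2)
  rw [← sa, ← sb, ← sc] at A
  have T := tri_ineq _ _ _ D pa pb pc A (by
    rw [sa, sb, sc]; nlinarith [sq_nonneg (x + y + z), sq_nonneg (u + v + w)])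
  obtain hp | hp := (add_nonneg (add_nonneg pa pb) pc).eq_or_lt
  · -- all three directions coincide
    have ha : √((w - u) ^ 2 + (x - z) ^ 2) = 0 := by linarith
    have hb : √((u - v) ^ 2 + (y - x) ^ 2) = 0 := by linarith
    rw [ha] at sb
    rw [hb] at sc
    have hz : x - z = 0 := pow_eq_zero_iff two_ne_zero |>.1
      (by linarith [sq_nonneg (w - u), sq_nonneg (x - z)])
    have hy : y - x = 0 := pow_eq_zero_iff two_ne_zero |>.1
      (by linarith [sq_nonneg (u - v), sq_nonneg (y - x)])
    have := K 1 0 x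
    rw [show x * 1 + u * 0 - x = 0 by ring, show y * 1 + v * 0 - x = 0 by linarith,
      show z * 1 + w * 0 - x = 0 by linarith] at this
    norm_num at this
    linarith
  · have hs : r * (√((v - w) ^ 2 + (z - y) ^ 2) + √((w - u) ^ 2 + (x - z) ^ 2)
        + √((u - v) ^ 2 + (y - x) ^ 2)) ≤ |D| := by
      have : |D| = α 0 * |D| + α 1 * |D| + α 2 * |D| := by
        linear_combination (-|D|) * hαsum
      linarith
    by_contra hcon
    push Not at hcon
    have := mul_lt_mul_of_pos_right hcon hp
    linarith
end

section
/- Let n_i = (cos(2πi/3), sin(2πi/3)) for i = 1,2,3 (the trine configuration of unit vectors in ℝ²) and α_i = 1/3. Then the closed ball of radius 1/2 centered at the origin is contained in the compatible region m = {2·Σᵢ qᵢ αᵢ nᵢ : 0 ≤ qᵢ ≤ 1, Σᵢ qᵢ αᵢ = 1/2}. Hence the three-outcome planar compatibility radius satisfies R^p(3) ≥ 1/2. -/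
open Real

/-- The trine configuration of unit vectors in `ℝ²`:
`n_i = (cos (2πi/3), sin (2πi/3))` for `i = 1, 2, 3`. -/
noncomputable def trine : Fin 3 → EuclideanSpace ℝ (Fin 2) := fun i =>
  (WithLp.equiv 2 (Fin 2 → ℝ)).symm
    ![Real.cos (2 * π * (i.1 + 1) / 3), Real.sin (2 * π * (i.1 + 1) / 3)]

/-- Lower bound `R^p(3) ≥ 1/2`: for the trine configuration with weights `α_i = 1/3`,
the closed ball of radius `1/2` centered at the origin is contained in the compatible
region. -/
theorem trine_closedBall_subset_compatRegion :
    Metric.closedBall (0 : EuclideanSpace ℝ (Fin 2)) (1 / 2) ⊆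
      compatRegion (fun _ => (1 / 3 : ℝ)) trine := by
  intro x hx
  have h3 : (√3 : ℝ) ^ 2 = 3 := Real.sq_sqrt (by norm_num)
  have hn : x 0 ^ 2 + x 1 ^ 2 ≤ 1 / 4 := by
    rw [mem_closedBall_zero_iff] at hx
    have h := EuclideanSpace.real_norm_sq_eq x
    rw [Fin.sum_univ_two] at h
    have h0 := norm_nonneg x
    nlinarith
  have c0 : Real.cos (2 * π / 3) = -(1 / 2) := by
    rw [show 2 * π / 3 = π - π / 3 by ring, Real.cos_pi_sub, Real.cos_pi_div_three]
  have s0 : Real.sin (2 * π / 3) = √3 / 2 := by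
    rw [show 2 * π / 3 = π - π / 3 by ring, Real.sin_pi_sub, Real.sin_pi_div_three]
  have c1 : Real.cos (2 * π * (1 + 1) / 3) = -(1 / 2) := by
    rw [show 2 * π * (1 + 1) / 3 = π / 3 + π by ring, Real.cos_add_pi, Real.cos_pi_div_three]
  have s1 : Real.sin (2 * π * (1 + 1) / 3) = -(√3 / 2) := by
    rw [show 2 * π * (1 + 1) / 3 = π / 3 + π by ring, Real.sin_add_pi, Real.sin_pi_div_three]
  have c2 : Real.cos (2 * π * (2 + 1) / 3) = 1 := by
    rw [show 2 * π * (2 + 1) / 3 = 2 * π by ring, Real.cos_two_pi]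
  have s2 : Real.sin (2 * π * (2 + 1) / 3) = 0 := by
    rw [show 2 * π * (2 + 1) / 3 = 2 * π by ring, Real.sin_two_pi]
  have key : ∀ t u : ℝ, t ^ 2 + u ^ 2 ≤ 1 / 4 → 0 ≤ 1 / 2 + t ∧ 1 / 2 + t ≤ 1 := by
    intro t u h
    constructor <;> nlinarith [sq_nonneg u, sq_nonneg (t - 1 / 2), sq_nonneg (t + 1 / 2)]
  refine ⟨![1 / 2 + (-(1 / 2) * x 0 + √3 / 2 * x 1),
    1 / 2 + (-(1 / 2) * x 0 - √3 / 2 * x 1), 1 / 2 + x 0], ?_, ?_, ?_⟩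
  · intro i
    fin_cases i
    · exact key _ (√3 / 2 * x 0 + 1 / 2 * x 1) (by
        linear_combination hn + (x 0 ^ 2 + x 1 ^ 2) / 4 * h3)
    · exact key _ (√3 / 2 * x 0 - 1 / 2 * x 1) (by
        linear_combination hn + (x 0 ^ 2 + x 1 ^ 2) / 4 * h3)
    · exact key _ (x 1) hn
  · simp [Fin.sum_univ_three]
    ring
  · ext j
    fin_cases j
    · simp [Fin.sum_univ_three, trine, c0, c1, c2]
      ring
    · simp [Fin.sum_univ_three, trine, s0, s1, s2]
      linear_combination (-(x 1) / 3) * h3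
end

section
/- Let n₁, n₂, n₃, n₄ be unit vectors in ℝ³ and let α₁,…,α₄ ≥ 0 with Σᵢ αᵢ = 1. Define the compatible region m = {2·Σᵢ qᵢ αᵢ nᵢ : 0 ≤ qᵢ ≤ 1, Σᵢ qᵢ αᵢ = 1/2} ⊆ ℝ³. If the closed ball of radius r ≥ 0 centered at the origin is contained in m, then r ≤ 1/3. (Upper bound R(4) ≤ 1/3 on the four-outcome compatibility radius.) -/
theorem exists_face (n : Fin 4 → EuclideanSpace ℝ (Fin 3)) (i : Fin 4) :
    ∃ (v : EuclideanSpace ℝ (Fin 3)) (t : ℝ), ‖v‖ = 1 ∧ (∀ j, j ≠ i → inner ℝ v (n j) = t) ∧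
      0 ≤ inner ℝ v (n i) - t := by
  let L : (EuclideanSpace ℝ (Fin 3) × ℝ) →ₗ[ℝ] ({j : Fin 4 // j ≠ i} → ℝ) :=
    LinearMap.pi fun j => ((innerSL ℝ (n j)).toLinearMap ∘ₗ LinearMap.fst ℝ _ _)
      - LinearMap.snd ℝ _ _
  have hker : LinearMap.ker L ≠ ⊥ := by
    apply LinearMap.ker_ne_bot_of_finrank_lt
    simp
  obtain ⟨⟨v, t⟩, hv, hne⟩ := Submodule.exists_mem_ne_zero_of_ne_bot hker
  have hvt : ∀ j, j ≠ i → inner ℝ v (n j) = t := by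
    intro j hj
    have := congrFun (LinearMap.mem_ker.1 hv) ⟨j, hj⟩
    simp [L] at this
    rw [real_inner_comm]; linarith
  have hv0 : v ≠ 0 := by
    rintro rfl
    obtain ⟨j, hj⟩ := exists_ne i
    have := hvt j hj
    simp at this
    exact hne (by simp [← this])
  have hpos : 0 < ‖v‖ := norm_pos_iff.2 hv0
  rcases le_total 0 (inner ℝ v (n i) - t) with h | h
  · refine ⟨‖v‖⁻¹ • v, ‖v‖⁻¹ * t, ?_, ?_, ?_⟩
    · simp [norm_smul, hpos.ne']
    · intro j hj; rw [real_inner_smul_left, hvt j hj]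
    · rw [real_inner_smul_left, ← mul_sub]; positivity
  · refine ⟨-(‖v‖⁻¹ • v), -(‖v‖⁻¹ * t), ?_, ?_, ?_⟩
    · simp [norm_smul, hpos.ne']
    · intro j hj; rw [inner_neg_left, real_inner_smul_left, hvt j hj]
    · rw [inner_neg_left, real_inner_smul_left]
      have : 0 ≤ ‖v‖⁻¹ * (t - inner ℝ v (n i)) := mul_nonneg (by positivity) (by linarith)
      linarith

theorem face_bound (n : Fin 4 → EuclideanSpace ℝ (Fin 3))
    (α : Fin 4 → ℝ) (hα : ∀ i, 0 ≤ α i) (r : ℝ) (hr : 0 ≤ r)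
    (hball : Metric.closedBall (0 : EuclideanSpace ℝ (Fin 3)) r ⊆ compatRegion α n)
    (i : Fin 4) (v : EuclideanSpace ℝ (Fin 3)) (t : ℝ) (hv : ‖v‖ = 1)
    (hvt : ∀ j, j ≠ i → inner ℝ v (n j) = t) (h0 : 0 ≤ inner ℝ v (n i) - t) :
    r ≤ α i * (inner ℝ v (n i) - t) := by
  have key : ∀ s : ℝ, |s| ≤ r → ∃ q : ℝ, 0 ≤ q ∧ q ≤ 1 ∧
      s - t = 2 * (q * α i) * (inner ℝ v (n i) - t) := by
    intro s hs
    obtain ⟨q, hq, hsum, hx⟩ := @hball (s • v) (by simp [norm_smul, hv, hs])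
    refine ⟨q i, (hq i).1, (hq i).2, ?_⟩
    have h1 : s = ∑ j, (2 * (q j * α j)) * inner ℝ v (n j) := by
      have := congrArg (fun y => inner ℝ v y) hx
      simpa [inner_sum, real_inner_smul_right, hv] using this
    have h2 : t = ∑ j, (2 * (q j * α j)) * t := by
      rw [← Finset.sum_mul, ← Finset.mul_sum, hsum]; ring
    have h3 : s - t = ∑ j, (2 * (q j * α j)) * (inner ℝ v (n j) - t) := by
      simp only [mul_sub, Finset.sum_sub_distrib]
      rw [← h1, ← h2]
    rw [h3]
    apply Finset.sum_eq_single i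
    · intro j _ hj; rw [hvt j hj]; ring
    · simp
  obtain ⟨q, hq0, hq1, hq⟩ := key r (abs_of_nonneg hr).le
  obtain ⟨p, hp0, hp1, hp⟩ := key (-r) (by rw [abs_neg, abs_of_nonneg hr])
  have hm : 0 ≤ α i * (inner ℝ v (n i) - t) := mul_nonneg (hα i) h0
  nlinarith [mul_nonneg hp0 hm, mul_nonneg (sub_nonneg.2 hq1) hm]

/-- Upper bound `R(4) ≤ 1/3` on the four-outcome compatibility radius: if the closed
ball of radius `r ≥ 0` about the origin is contained in the compatible region of a
four-outcome qubit POVM (unit directions in `ℝ³`), then `r ≤ 1/3`. -/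
theorem four_outcome_radius_le_third
    (n : Fin 4 → EuclideanSpace ℝ (Fin 3)) (hn : ∀ i, ‖n i‖ = 1)
    (α : Fin 4 → ℝ) (hα : ∀ i, 0 ≤ α i) (hαsum : ∑ i, α i = 1)
    (r : ℝ) (hr : 0 ≤ r)
    (hball : Metric.closedBall (0 : EuclideanSpace ℝ (Fin 3)) r ⊆ compatRegion α n) :
    r ≤ 1 / 3 := by
  choose v t hv hvt h0 using exists_face n
  have hb := fun i => face_bound n α hα r hr hball i (v i) (t i) (hv i) (hvt i) (h0 i)
  by_cases hz : ∃ i, inner ℝ (v i) (n i) - t i = 0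
  · obtain ⟨i, hi⟩ := hz
    have := hb i
    rw [hi] at this; linarith
  push Not at hz
  let L : (Fin 4 → ℝ) →ₗ[ℝ] EuclideanSpace ℝ (Fin 3) := Fintype.linearCombination ℝ n
  have hker : LinearMap.ker L ≠ ⊥ := by
    apply LinearMap.ker_ne_bot_of_finrank_lt
    simp
  obtain ⟨c, hc, hne⟩ := Submodule.exists_mem_ne_zero_of_ne_bot hker
  have hc : ∑ j, c j • n j = 0 := by
    have := LinearMap.mem_ker.1 hc
    simpa [L, Fintype.linearCombination_apply] using this
  have hrel : ∀ i, c i * (inner ℝ (v i) (n i) - t i) + t i * ∑ j, c j = 0 := by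
    intro i
    have h1 : ∑ j, c j * inner ℝ (v i) (n j) = 0 := by
      have := congrArg (fun y => inner ℝ (v i) y) hc
      simpa [inner_sum, real_inner_smul_right] using this
    have h2 : ∑ j, c j * (inner ℝ (v i) (n j) - t i) = c i * (inner ℝ (v i) (n i) - t i) := by
      apply Finset.sum_eq_single i
      · intro j _ hj; rw [hvt i j hj]; ring
      · simp
    rw [← h2]
    simp only [mul_sub, Finset.sum_sub_distrib]
    rw [h1, ← Finset.sum_mul]; ring
  have hS : ∑ j, c j ≠ 0 := by
    intro hS
    apply hne
    funext i
    have := hrel i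
    rw [hS, mul_zero, add_zero] at this
    exact (mul_eq_zero.1 this).resolve_right (hz i)
  have hi : ∀ i, r * (1 - c i / ∑ j, c j) ≤ α i := by
    intro i
    rcases le_total (1 - c i / ∑ j, c j) 0 with h | h
    · exact (mul_nonpos_of_nonneg_of_nonpos hr h).trans (hα i)
    · have e : (inner ℝ (v i) (n i) - t i) * (1 - c i / ∑ j, c j) = inner ℝ (v i) (n i) := by
        field_simp
        linarith [hrel i]
      have hle : inner ℝ (v i) (n i) ≤ 1 := by
        have := real_inner_le_norm (v i) (n i)
        rwa [hv, hn, mul_one] at this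
      calc r * (1 - c i / ∑ j, c j)
          ≤ α i * (inner ℝ (v i) (n i) - t i) * (1 - c i / ∑ j, c j) :=
            mul_le_mul_of_nonneg_right (hb i) h
        _ = α i * inner ℝ (v i) (n i) := by rw [mul_assoc, e]
        _ ≤ α i * 1 := mul_le_mul_of_nonneg_left hle (hα i)
        _ = α i := mul_one _
  have hs : ∑ i, r * (1 - c i / ∑ j, c j) ≤ 1 :=
    (Finset.sum_le_sum fun i _ => hi i).trans hαsum.le
  rw [← Finset.mul_sum, Finset.sum_sub_distrib, ← Finset.sum_div, div_self hS] at hs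
  simp at hs
  linarith
end

section
/- Let n₁ = (1,1,1)/√3, n₂ = (1,−1,−1)/√3, n₃ = (−1,1,−1)/√3, n₄ = (−1,−1,1)/√3 be the tetrahedral unit vectors in ℝ³ and α_i = 1/4. Then the closed ball of radius 1/3 centered at the origin is contained in the compatible region m = {2·Σᵢ qᵢ αᵢ nᵢ : 0 ≤ qᵢ ≤ 1, Σᵢ qᵢ αᵢ = 1/2}. Hence the four-outcome compatibility radius satisfies R(4) ≥ 1/3. -/
/-- The tetrahedral unit vectors in `ℝ³`:
`(1,1,1)/√3, (1,−1,−1)/√3, (−1,1,−1)/√3, (−1,−1,1)/√3`. -/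
noncomputable def tetra : Fin 4 → EuclideanSpace ℝ (Fin 3) := fun i =>
  (Real.sqrt 3)⁻¹ • (WithLp.equiv 2 (Fin 3 → ℝ)).symm
    (![![1, 1, 1], ![1, -1, -1], ![-1, 1, -1], ![-1, -1, 1]] i)

/-- Lower bound `R(4) ≥ 1/3`: for the tetrahedral configuration with weights `α_i = 1/4`,
the closed ball of radius `1/3` centered at the origin is contained in the compatible
region. -/
theorem tetra_closedBall_subset_compatRegion :
    Metric.closedBall (0 : EuclideanSpace ℝ (Fin 3)) (1 / 3) ⊆
      compatRegion (fun _ => (1 / 4 : ℝ)) tetra := by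
  intro x hx
  have hn : x 0 ^ 2 + x 1 ^ 2 + x 2 ^ 2 ≤ 1 / 9 := by
    have h1 : ‖x‖ ≤ 1 / 3 := by simpa using hx
    have h2 := EuclideanSpace.real_norm_sq_eq x
    rw [Fin.sum_univ_three] at h2
    have h3 := norm_nonneg x
    nlinarith
  have hs : Real.sqrt 3 * Real.sqrt 3 = 3 := Real.mul_self_sqrt (by norm_num)
  have hs0 : Real.sqrt 3 ≠ 0 := by positivity
  have key : ∀ e f : ℝ, ∀ g : ℝ, e ^ 2 = 1 → f ^ 2 = 1 → g ^ 2 = 1 →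
      0 ≤ 1 / 2 + Real.sqrt 3 / 2 * (e * x 0 + f * x 1 + g * x 2) ∧
      1 / 2 + Real.sqrt 3 / 2 * (e * x 0 + f * x 1 + g * x 2) ≤ 1 := by
    intro e f g he hf hg
    have hc : (e * x 0 + f * x 1 + g * x 2) ^ 2 ≤ 3 * (x 0 ^ 2 + x 1 ^ 2 + x 2 ^ 2) := by
      have : (e * x 0) ^ 2 + (f * x 1) ^ 2 + (g * x 2) ^ 2 = x 0 ^ 2 + x 1 ^ 2 + x 2 ^ 2 := by
        rw [mul_pow, mul_pow, mul_pow, he, hf, hg]; ring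
      nlinarith [sq_nonneg (e * x 0 - f * x 1), sq_nonneg (e * x 0 - g * x 2),
        sq_nonneg (f * x 1 - g * x 2)]
    have hb : (Real.sqrt 3 * (e * x 0 + f * x 1 + g * x 2)) ^ 2 ≤ 1 := by
      rw [mul_pow, pow_two (Real.sqrt 3), hs]; linarith
    have := abs_le.mp ((sq_le_one_iff_abs_le_one _).mp hb)
    constructor <;> linarith [this.1, this.2]
  refine ⟨![1 / 2 + Real.sqrt 3 / 2 * (1 * x 0 + 1 * x 1 + 1 * x 2),
    1 / 2 + Real.sqrt 3 / 2 * (1 * x 0 + (-1) * x 1 + (-1) * x 2),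
    1 / 2 + Real.sqrt 3 / 2 * ((-1) * x 0 + 1 * x 1 + (-1) * x 2),
    1 / 2 + Real.sqrt 3 / 2 * ((-1) * x 0 + (-1) * x 1 + 1 * x 2)], ?_, ?_, ?_⟩
  · intro i
    fin_cases i
    · exact key 1 1 1 (by norm_num) (by norm_num) (by norm_num)
    · exact key 1 (-1) (-1) (by norm_num) (by norm_num) (by norm_num)
    · exact key (-1) 1 (-1) (by norm_num) (by norm_num) (by norm_num)
    · exact key (-1) (-1) 1 (by norm_num) (by norm_num) (by norm_num)
  · simp [Fin.sum_univ_four]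
    ring
  · ext j
    fin_cases j <;> simp [Fin.sum_univ_four, tetra] <;> field_simp <;> ring
end

section
/- For every n ≥ 2, every family of unit vectors n₁,…,n_n in ℝ², and every weights α₁,…,α_n ≥ 0 with Σᵢ αᵢ = 1, there exists a unit vector c ∈ ℝ² such that Σᵢ αᵢ·|⟨nᵢ, c⟩| ≤ (1/n)·cot(π/(2n)). (Isoperimetric upper bound R^p(n) ≤ (1/n)cot(π/(2n)) on the n-outcome planar compatibility radius.) -/
open Real
open scoped RealInnerProductSpace

lemma aux_convex_tan : ConvexOn ℝ (Set.Ico 0 (π/2)) Real.tan := by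
  have hc : ∀ x ∈ Set.Ico (0:ℝ) (π/2), 0 < Real.cos x := fun x hx =>
    Real.cos_pos_of_mem_Ioo ⟨by linarith [hx.1, Real.pi_pos], hx.2⟩
  apply MonotoneOn.convexOn_of_deriv (convex_Ico _ _)
  · intro x hx
    exact (Real.continuousAt_tan.2 (hc x hx).ne').continuousWithinAt
  · intro x hx
    rw [interior_Ico] at hx
    exact (Real.differentiableAt_tan.2 (hc x ⟨hx.1.le, hx.2⟩).ne').differentiableWithinAt
  · intro x hx y hy hxy
    rw [interior_Ico] at hx hy
    rw [Real.deriv_tan, Real.deriv_tan]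
    have h1 := hc y ⟨hy.1.le, hy.2⟩
    have h2 : Real.cos y ≤ Real.cos x :=
      Real.cos_le_cos_of_nonneg_of_le_pi hx.1.le (by linarith [hy.2, Real.pi_pos]) hxy
    gcongr

/-- Antiderivative of `|sin (θ - ψ)|` on `[ψ - π, ψ + π]`. -/
noncomputable def auxG (ψ θ : ℝ) : ℝ :=
  if θ ≤ ψ then Real.cos (θ - ψ) else 2 - Real.cos (θ - ψ)

lemma aux_trig (a b : ℝ) : (Real.sin a + Real.sin b) * Real.sin ((b - a)/2)
    = (Real.cos a - Real.cos b) * Real.cos ((b - a)/2) := by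
  obtain ⟨m, d, rfl, rfl⟩ : ∃ m d : ℝ, a = m - d ∧ b = m + d :=
    ⟨(a+b)/2, (b-a)/2, by ring, by ring⟩
  have : (m + d - (m - d))/2 = d := by ring
  rw [this, Real.sin_sub, Real.sin_add, Real.cos_sub, Real.cos_add]
  ring

lemma auxG_of_ge (ψ θ : ℝ) (h : ψ ≤ θ) : auxG ψ θ = 2 - Real.cos (θ - ψ) := by
  unfold auxG
  split_ifs with h1
  · have : θ = ψ := le_antisymm h1 h
    subst this
    norm_num
  · rfl

lemma aux_gap (ψ a b : ℝ) (hab : a ≤ b) (ha : ψ - π ≤ a) (hb : b ≤ ψ + π)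
    (h : ψ ≤ a ∨ b ≤ ψ) :
    (|Real.sin (a - ψ)| + |Real.sin (b - ψ)|) * Real.sin ((b - a)/2)
      = (auxG ψ b - auxG ψ a) * Real.cos ((b - a)/2) := by
  have key := aux_trig (a - ψ) (b - ψ)
  have e : (b - ψ - (a - ψ))/2 = (b - a)/2 := by ring
  rw [e] at key
  rcases h with h | h
  · rw [auxG_of_ge _ _ h, auxG_of_ge _ _ (h.trans hab),
      abs_of_nonneg (Real.sin_nonneg_of_nonneg_of_le_pi (by linarith) (by linarith)),
      abs_of_nonneg (Real.sin_nonneg_of_nonneg_of_le_pi (by linarith) (by linarith))]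
    linarith
  · rw [auxG, auxG, if_pos h, if_pos (hab.trans h),
      abs_of_nonpos (Real.sin_nonpos_of_nonpos_of_neg_pi_le (by linarith) (by linarith)),
      abs_of_nonpos (Real.sin_nonpos_of_nonpos_of_neg_pi_le (by linarith) (by linarith))]
    linarith

lemma aux_core {ι : Type*} [Fintype ι] (n : ℕ) (hn : 2 ≤ n) (ψ α : ι → ℝ)
    (hαsum : ∑ i, α i = 1)
    (φ : ℕ → ℝ) (hmono : ∀ k < n, φ k ≤ φ (k+1)) (hφn : φ n = φ 0 + π)
    (hge : ∀ k ≤ n, φ 0 ≤ φ k) (hle : ∀ k ≤ n, φ k ≤ φ n)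
    (h0 : ∀ i, φ 0 ≤ ψ i) (h1 : ∀ i, ψ i < φ n)
    (hgap : ∀ k < n, ∀ i, ψ i ≤ φ k ∨ φ (k+1) ≤ ψ i) (r : ℝ) (hr : 0 < r)
    (hf : ∀ k ≤ n, r ≤ ∑ i, α i * |Real.sin (φ k - ψ i)|) :
    r * (n * Real.tan (π / (2 * n))) ≤ 1 := by
  set D : ℕ → ℝ := fun k => ∑ i, α i * auxG (ψ i) (φ k) with hD
  have hD2 : D n - D 0 = 2 := by
    simp only [hD]
    rw [← Finset.sum_sub_distrib]
    have : ∀ i, α i * auxG (ψ i) (φ n) - α i * auxG (ψ i) (φ 0) = 2 * α i := by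
      intro i
      rw [auxG_of_ge _ _ (h1 i).le, auxG, if_pos (h0 i), hφn]
      have : φ 0 + π - ψ i = (φ 0 - ψ i) + π := by ring
      rw [this, Real.cos_add_pi]
      ring
    rw [Finset.sum_congr rfl fun i _ => this i, ← Finset.mul_sum, hαsum]
    norm_num
  have hgapk : ∀ k < n, (φ (k+1) - φ k)/2 ∈ Set.Ico 0 (π/2) ∧
      2 * r * Real.tan ((φ (k+1) - φ k)/2) ≤ D (k+1) - D k := by
    intro k hk
    have hm := hmono k hk
    have g1 := hge k hk.le
    have g2 := hle (k+1) hk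
    have hx0 : 0 ≤ (φ (k+1) - φ k)/2 := by linarith
    have hx1 : (φ (k+1) - φ k)/2 ≤ π/2 := by linarith
    have hs : 0 ≤ Real.sin ((φ (k+1) - φ k)/2) :=
      Real.sin_nonneg_of_nonneg_of_le_pi hx0 (by linarith [Real.pi_pos])
    have id : (∑ i, α i * |Real.sin (φ k - ψ i)| + ∑ i, α i * |Real.sin (φ (k+1) - ψ i)|)
        * Real.sin ((φ (k+1) - φ k)/2)
        = (D (k+1) - D k) * Real.cos ((φ (k+1) - φ k)/2) := by
      simp only [hD]
      rw [← Finset.sum_add_distrib, ← Finset.sum_sub_distrib, Finset.sum_mul, Finset.sum_mul]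
      refine Finset.sum_congr rfl fun i _ => ?_
      have := aux_gap (ψ i) (φ k) (φ (k+1)) hm (by linarith [h1 i]) (by linarith [h0 i])
        (hgap k hk i)
      linear_combination α i * this
    have f1 := hf k hk.le
    have f2 := hf (k+1) hk
    have hlt : (φ (k+1) - φ k)/2 < π/2 := by
      rcases hx1.lt_or_eq with h | h
      · exact h
      · exfalso
        rw [h, Real.sin_pi_div_two, Real.cos_pi_div_two] at id
        linarith
    have hc : 0 < Real.cos ((φ (k+1) - φ k)/2) :=
      Real.cos_pos_of_mem_Ioo ⟨by linarith [Real.pi_pos], hlt⟩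
    refine ⟨⟨hx0, hlt⟩, ?_⟩
    rw [Real.tan_eq_sin_div_cos, ← mul_div_assoc, div_le_iff₀ hc, ← id]
    exact mul_le_mul_of_nonneg_right (by linarith) hs
  have hn0 : (0:ℝ) < n := by exact_mod_cast (by omega : 0 < n)
  have jen := aux_convex_tan.map_sum_le (t := Finset.range n) (w := fun _ => (1:ℝ)/n)
    (p := fun k => (φ (k+1) - φ k)/2) (fun _ _ => by positivity)
    (by simp [hn0.ne']) (fun k hk => (hgapk k (Finset.mem_range.1 hk)).1)
  simp only [smul_eq_mul, ← Finset.mul_sum] at jen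
  rw [← Finset.sum_div, Finset.sum_range_sub, hφn] at jen
  have e : 1 / (n:ℝ) * ((φ 0 + π - φ 0)/2) = π / (2 * n) := by
    field_simp
    ring
  rw [e, one_div, ← div_eq_inv_mul, le_div_iff₀ hn0] at jen
  have tot : ∑ k ∈ Finset.range n, 2 * r * Real.tan ((φ (k+1) - φ k)/2)
      ≤ ∑ k ∈ Finset.range n, (D (k+1) - D k) :=
    Finset.sum_le_sum fun k hk => (hgapk k (Finset.mem_range.1 hk)).2
  rw [Finset.sum_range_sub, hD2, ← Finset.mul_sum] at tot
  nlinarith [mul_le_mul_of_nonneg_left jen hr.le]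

lemma aux_angle (w : EuclideanSpace ℝ (Fin 2)) (hw : ‖w‖ = 1) :
    ∃ ψ : ℝ, 0 < ψ ∧ ψ ≤ π ∧ ∀ θ : ℝ,
      |⟪w, !₂[-Real.sin θ, Real.cos θ]⟫| = |Real.sin (θ - ψ)| := by
  have hz : w 0 ^ 2 + w 1 ^ 2 = 1 := by
    have := EuclideanSpace.real_norm_sq_eq w
    rw [hw, Fin.sum_univ_two] at this
    linarith
  set z : ℂ := ⟨w 0, w 1⟩ with hzdef
  have hzn : ‖z‖ = 1 := by
    rw [← sq_eq_sq₀ (norm_nonneg _) zero_le_one, Complex.sq_norm, Complex.normSq_mk]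
    linarith
  have hc : Real.cos z.arg = w 0 := by
    have := Complex.norm_mul_cos_arg z
    rw [hzn, one_mul] at this
    exact this
  have hs : Real.sin z.arg = w 1 := by
    have := Complex.norm_mul_sin_arg z
    rw [hzn, one_mul] at this
    exact this
  have hin : ∀ θ : ℝ, ⟪w, !₂[-Real.sin θ, Real.cos θ]⟫ = - Real.sin (θ - z.arg) := by
    intro θ
    rw [Real.sin_sub, hc, hs, PiLp.inner_apply, Fin.sum_univ_two]
    simp
    ring
  by_cases h : 0 < z.arg
  · exact ⟨z.arg, h, Complex.arg_le_pi z, fun θ => by rw [hin, abs_neg]⟩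
  · refine ⟨z.arg + π, by linarith [Complex.neg_pi_lt_arg z], by linarith, fun θ => ?_⟩
    rw [hin, ← sub_sub, Real.sin_sub_pi]

/-- Isoperimetric upper bound `R^p(n) ≤ (1/n)·cot(π/(2n))` on the `n`-outcome planar
compatibility radius: for any `n ≥ 2` unit vectors in `ℝ²` and weights summing to 1,
there is a unit vector `c` with `Σᵢ αᵢ|⟨nᵢ, c⟩| ≤ (1/n)·cot(π/(2n))`. -/
theorem planar_radius_isoperimetric_upper_bound
    (n : ℕ) (hn : 2 ≤ n)
    (v : Fin n → EuclideanSpace ℝ (Fin 2)) (hv : ∀ i, ‖v i‖ = 1)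
    (α : Fin n → ℝ) (hα : ∀ i, 0 ≤ α i) (hαsum : ∑ i, α i = 1) :
    ∃ c : EuclideanSpace ℝ (Fin 2), ‖c‖ = 1 ∧
      ∑ i, α i * |⟪v i, c⟫| ≤
        (1 / n) * (Real.cos (π / (2 * n)) / Real.sin (π / (2 * n))) := by
  by_contra! hcon
  choose ψ hψ0 hψ1 hψ using fun i => aux_angle (v i) (hv i)
  have hn0 : (0:ℝ) < n := by exact_mod_cast (by omega : 0 < n)
  have hn2 : (2:ℝ) ≤ n := by exact_mod_cast hn
  have hx0 : 0 < π / (2 * n) := by positivity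
  have hx1 : π / (2 * n) < π / 2 := by
    apply div_lt_div_of_pos_left Real.pi_pos (by norm_num) (by linarith)
  have hsin : 0 < Real.sin (π / (2 * n)) := Real.sin_pos_of_pos_of_lt_pi hx0 (by linarith)
  have hcos : 0 < Real.cos (π / (2 * n)) := Real.cos_pos_of_mem_Ioo ⟨by linarith, hx1⟩
  set r₀ := (1 / (n:ℝ)) * (Real.cos (π / (2 * n)) / Real.sin (π / (2 * n))) with hr₀
  have hr₀pos : 0 < r₀ := by positivity
  have hprod : r₀ * (n * Real.tan (π / (2 * n))) = 1 := by
    rw [hr₀, Real.tan_eq_sin_div_cos]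
    generalize π / (2 * (n:ℝ)) = x at hsin hcos
    field_simp
  have hf : ∀ θ, r₀ < ∑ i, α i * |Real.sin (θ - ψ i)| := by
    intro θ
    have hnorm : ‖(!₂[-Real.sin θ, Real.cos θ] : EuclideanSpace ℝ (Fin 2))‖ = 1 := by
      rw [EuclideanSpace.norm_eq, Fin.sum_univ_two]
      simp
    have := hcon _ hnorm
    simpa only [hψ] using this
  have hnpos : 0 < n := by omega
  set σ := Tuple.sort ψ with hσ
  have hsort : Monotone (ψ ∘ σ) := Tuple.monotone_sort ψ
  set φ : ℕ → ℝ := fun k => if h : k < n then ψ (σ ⟨k, h⟩) else ψ (σ ⟨0, hnpos⟩) + π with hφ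
  have hlt : ∀ k (h : k < n), φ k = ψ (σ ⟨k, h⟩) := fun k h => by simp [hφ, h]
  have hφn' : φ n = ψ (σ ⟨0, hnpos⟩) + π := by simp [hφ]
  have hφ0 := hlt 0 hnpos
  have hφn : φ n = φ 0 + π := by rw [hφn', hφ0]
  have hψφ : ∀ i, ∃ j, ∃ h : j < n, ψ i = φ j ∧ i = σ ⟨j, h⟩ := by
    intro i
    refine ⟨(σ.symm i).1, (σ.symm i).2, ?_, ?_⟩
    · rw [hlt _ (σ.symm i).2]
      simp
    · simp
  have hmon : ∀ j k, j ≤ k → k ≤ n → φ j ≤ φ k := by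
    intro j k hjk hk
    rcases hk.lt_or_eq with h | h
    · rw [hlt j (by omega), hlt k h]
      exact hsort (by simpa using hjk)
    · subst h
      rcases hjk.lt_or_eq with h' | h'
      · rw [hlt j h', hφn']
        linarith [hψ1 (σ ⟨j, h'⟩), hψ0 (σ ⟨0, hnpos⟩)]
      · rw [h']
  obtain ⟨m, -, hm⟩ := Finset.exists_min_image (Finset.range (n+1))
    (fun k => ∑ i, α i * |Real.sin (φ k - ψ i)|) ⟨0, by simp⟩
  have hrm := hf (φ m)
  have main := aux_core n hn ψ α hαsum φ (fun k hk => hmon k (k+1) (by omega) hk) hφn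
    (fun k hk => hmon 0 k (by omega) hk) (fun k hk => hmon k n hk le_rfl)
    (fun i => by
      obtain ⟨j, h, e, -⟩ := hψφ i
      rw [e]
      exact hmon 0 j (by omega) h.le)
    (fun i => by
      rw [hφn']
      linarith [hψ1 i, hψ0 (σ ⟨0, hnpos⟩)])
    (fun k hk i => by
      obtain ⟨j, h, e, -⟩ := hψφ i
      rw [e]
      rcases Nat.lt_or_ge k j with hkj | hkj
      · exact Or.inr (hmon (k+1) j hkj h.le)
      · exact Or.inl (hmon j k hkj hk.le))
    (∑ i, α i * |Real.sin (φ m - ψ i)|) (hr₀pos.trans hrm)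
    (fun k hk => hm k (by simpa using Nat.lt_succ_of_le hk))
  have htan : 0 < n * Real.tan (π / (2 * n)) := by
    rw [Real.tan_eq_sin_div_cos]
    positivity
  have := mul_lt_mul_of_pos_right hrm htan
  linarith
end

section
/- There exists a constant c > 0 such that for every n ≥ 1, every family of unit vectors n₁,…,n_n in ℝ³, and every weights α₁,…,α_n ≥ 0 with Σᵢ αᵢ = 1, there exists a unit vector c' ∈ ℝ³ with Σᵢ αᵢ·|⟨nᵢ, c'⟩| ≤ 1/2 − c·n^{−5/2}. (Upper bound R(n) ≤ 1/2 − c·n^{−5/2} on the n-outcome compatibility radius for the full Bloch sphere, implying the simulation cost lower bound γ(ω_r) = Ω((1/2 − r)^{−2/5}).) -/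
open scoped RealInnerProductSpace
open MeasureTheory

theorem frub_gauss (v : EuclideanSpace ℝ (Fin 3)) (hv : ‖v‖ = 1) (g : ℝ → ℝ) :
    ∫ x : EuclideanSpace ℝ (Fin 3), g ⟪v, x⟫ * Real.exp (-‖x‖ ^ 2)
      = (∫ z : ℝ, g z * Real.exp (-z ^ 2)) * Real.pi := by
  obtain ⟨b, hb⟩ := Orthonormal.exists_orthonormalBasis_extension_of_card_eq (𝕜 := ℝ)
    (E := EuclideanSpace ℝ (Fin 3)) (ι := Fin 3) (by simp) (v := fun _ => v) (s := {0})
    (by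
      constructor
      · intro i; simpa using hv
      · intro i j hij
        exact absurd (Subsingleton.elim i j) hij)
  have hb0 : b 0 = v := hb 0 rfl
  have h1 := b.measurePreserving_measurableEquiv.integral_comp'
    (g := fun y : EuclideanSpace ℝ (Fin 3) => g (y 0) * Real.exp (-‖y‖ ^ 2))
  have h2 := (EuclideanSpace.volume_preserving_symm_measurableEquiv_toLp (Fin 3)).integral_comp'
    (g := fun y : Fin 3 → ℝ => ∏ i, ((if i = 0 then g (y i) else 1) * Real.exp (-(y i) ^ 2)))
  have h3 : ∀ x, b.measurableEquiv x = b.repr x := fun x => rfl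
  have h4 : ∀ x : EuclideanSpace ℝ (Fin 3), (b.repr x) 0 = ⟪v, x⟫ := fun x => by
    rw [b.repr_apply_apply, hb0]
  simp only [h3, h4, LinearIsometryEquiv.norm_map] at h1
  rw [h1]
  have hs := Real.mul_self_sqrt Real.pi_pos.le
  have hg : ∫ z : ℝ, Real.exp (-z ^ 2) = √Real.pi := by simpa using integral_gaussian 1
  calc _ = _ := ?_
    _ = _ := h2
    _ = _ := ?_
  · congr 1
    ext x
    simp only [EuclideanSpace.norm_sq_eq, Fin.sum_univ_three, Fin.prod_univ_three]
    simp
    rw [mul_assoc, mul_assoc, ← Real.exp_add, ← Real.exp_add]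
    congr 2
    ring
  · rw [integral_fintype_prod_volume_eq_prod
      (f := fun i z => (if i = 0 then g z else 1) * Real.exp (-z ^ 2))]
    simp [Fin.prod_univ_three, hg, mul_assoc, hs]

theorem frub_abs1 : ∫ z : ℝ, |z| * Real.exp (-z ^ 2) = 1 := by
  have := integral_comp_abs (f := fun z => z * Real.exp (-z ^ 2))
  simp only [sq_abs] at this
  rw [this]
  have h := integral_rpow_mul_exp_neg_mul_rpow (p := 2) (q := 1) (b := 1) (by norm_num) (by norm_num) (by norm_num)
  norm_num at h
  rw [h]; norm_num

theorem frub_norm : ∫ x : EuclideanSpace ℝ (Fin 3), ‖x‖ * Real.exp (-‖x‖ ^ 2) = 2 * Real.pi := by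
  have h := integral_fun_norm_addHaar (volume : Measure (EuclideanSpace ℝ (Fin 3)))
    (fun y => y * Real.exp (-y ^ 2))
  have h' := integral_rpow_mul_exp_neg_mul_rpow (p := 2) (q := 3) (b := 1) (by norm_num) (by norm_num) (by norm_num)
  rw [h]
  have e : ∫ y in Set.Ioi (0:ℝ), y ^ (3 - 1) • (y * Real.exp (-y ^ 2)) = 1 / 2 := by
    norm_num at h'
    rw [← h']
    congr 1; ext y
    have : y ^ (3:ℝ) = y ^ 3 := by exact_mod_cast Real.rpow_natCast y 3
    simp only [smul_eq_mul]
    ring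
  simp only [finrank_euclideanSpace, Fintype.card_fin]
  rw [e]
  simp only [Measure.real, EuclideanSpace.volume_ball_fin_three]
  rw [ENNReal.ofReal_one, one_pow, one_mul, ENNReal.toReal_ofReal (by positivity)]
  simp only [nsmul_eq_mul, smul_eq_mul]
  push_cast
  ring

theorem frub_perp (x : EuclideanSpace ℝ (Fin 3)) :
    ∃ u : EuclideanSpace ℝ (Fin 3), ‖u‖ = 1 ∧ ⟪x, u⟫ = 0 := by
  have h : LinearMap.ker (innerₛₗ ℝ x) ≠ ⊥ := LinearMap.ker_ne_bot_of_finrank_lt (by simp)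
  obtain ⟨w, hw, hw0⟩ := Submodule.exists_mem_ne_zero_of_ne_bot h
  have hw1 : ⟪x, w⟫ = 0 := by simpa using hw
  refine ⟨‖w‖⁻¹ • w, ?_, ?_⟩
  · rw [norm_smul, norm_inv, norm_norm, inv_mul_cancel₀ (norm_ne_zero_iff.2 hw0)]
  · rw [inner_smul_right, hw1, mul_zero]

theorem frub_hom {n : ℕ} (v : Fin n → EuclideanSpace ℝ (Fin 3)) (α : Fin n → ℝ) (m : ℝ)
    (hm : ∀ c : EuclideanSpace ℝ (Fin 3), ‖c‖ = 1 → m ≤ ∑ i, α i * |⟪v i, c⟫|)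
    (x : EuclideanSpace ℝ (Fin 3)) : m * ‖x‖ ≤ ∑ i, α i * |⟪v i, x⟫| := by
  by_cases hx : x = 0
  · simp [hx]
  have hx' : 0 < ‖x‖ := norm_pos_iff.2 hx
  have h := hm (‖x‖⁻¹ • x) (by
    rw [norm_smul, norm_inv, norm_norm, inv_mul_cancel₀ hx'.ne'])
  have e : ∑ i, α i * |⟪v i, ‖x‖⁻¹ • x⟫| = ‖x‖⁻¹ * ∑ i, α i * |⟪v i, x⟫| := by
    rw [Finset.mul_sum]
    refine Finset.sum_congr rfl fun i _ => ?_
    rw [inner_smul_right, abs_mul, abs_of_pos (inv_pos.2 hx')]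
    ring
  rw [e] at h
  calc m * ‖x‖ ≤ (‖x‖⁻¹ * ∑ i, α i * |⟪v i, x⟫|) * ‖x‖ := by gcongr
    _ = _ := by field_simp

theorem frub_good {n : ℕ} (v : Fin n → EuclideanSpace ℝ (Fin 3)) (hv : ∀ i, ‖v i‖ = 1)
    (α : Fin n → ℝ) (m : ℝ)
    (hm : ∀ c : EuclideanSpace ℝ (Fin 3), ‖c‖ = 1 → m ≤ ∑ i, α i * |⟪v i, c⟫|)
    (δ : ℝ) (hδ : 0 ≤ δ)
    (x : EuclideanSpace ℝ (Fin 3)) (hx : ∀ i, δ ≤ |⟪v i, x⟫|) :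
    m * √(‖x‖ ^ 2 + δ ^ 2) ≤ ∑ i, α i * |⟪v i, x⟫| := by
  obtain ⟨u, hu, hxu⟩ := frub_perp x
  have n1 : ‖x + δ • u‖ = √(‖x‖ ^ 2 + δ ^ 2) := by
    rw [eq_comm, Real.sqrt_eq_iff_mul_self_eq (by positivity) (norm_nonneg _), ← sq,
      norm_add_sq_real, inner_smul_right, hxu, norm_smul, hu, Real.norm_eq_abs]
    simp
  have n2 : ‖x - δ • u‖ = √(‖x‖ ^ 2 + δ ^ 2) := by
    rw [eq_comm, Real.sqrt_eq_iff_mul_self_eq (by positivity) (norm_nonneg _), ← sq,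
      norm_sub_sq_real, inner_smul_right, hxu, norm_smul, hu, Real.norm_eq_abs]
    simp
  have h1 := frub_hom v α m hm (x + δ • u)
  have h2 := frub_hom v α m hm (x - δ • u)
  rw [n1] at h1
  rw [n2] at h2
  have h3 : ∑ i, α i * |⟪v i, x + δ • u⟫| + ∑ i, α i * |⟪v i, x - δ • u⟫|
      = 2 * ∑ i, α i * |⟪v i, x⟫| := by
    rw [← Finset.sum_add_distrib, Finset.mul_sum]
    refine Finset.sum_congr rfl fun i _ => ?_
    have hi : |⟪v i, δ • u⟫| ≤ |⟪v i, x⟫| := by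
      refine le_trans ?_ (hx i)
      have := abs_real_inner_le_norm (v i) u
      rw [hv i, hu, one_mul] at this
      rw [inner_smul_right, abs_mul, abs_of_nonneg hδ]
      nlinarith
    rw [inner_add_right, inner_sub_right, ← mul_add]
    have : |⟪v i, x⟫ + ⟪v i, δ • u⟫| + |⟪v i, x⟫ - ⟪v i, δ • u⟫| = 2 * |⟪v i, x⟫| := by
      generalize ⟪v i, x⟫ = a at *
      generalize ⟪v i, δ • u⟫ = b at *
      rcases abs_cases a with ⟨h, _⟩ | ⟨h, _⟩ <;> rcases abs_le.1 hi with ⟨_, _⟩ <;>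
      rcases abs_cases (a + b) with ⟨h', _⟩ | ⟨h', _⟩ <;>
      rcases abs_cases (a - b) with ⟨h'', _⟩ | ⟨h'', _⟩ <;> linarith
    rw [this]; ring
  linarith

/-- indicator of the slab -/
noncomputable def frubS (δ : ℝ) : ℝ → ℝ := Set.indicator (Set.Ioo (-δ) δ) 1

theorem frub_pointwise {n : ℕ} (v : Fin n → EuclideanSpace ℝ (Fin 3)) (hv : ∀ i, ‖v i‖ = 1)
    (α : Fin n → ℝ) (m : ℝ) (hm0 : 0 ≤ m)
    (hm : ∀ c : EuclideanSpace ℝ (Fin 3), ‖c‖ = 1 → m ≤ ∑ i, α i * |⟪v i, c⟫|)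
    (δ : ℝ) (hδ : 0 ≤ δ) (hδ1 : δ ≤ 1) (x : EuclideanSpace ℝ (Fin 3)) :
    m * ‖x‖ + m * δ ^ 2 / 3 * ((Metric.ball (0 : EuclideanSpace ℝ (Fin 3)) 1).indicator 1 x
      - ∑ i, frubS δ ⟪v i, x⟫) ≤ ∑ i, α i * |⟪v i, x⟫| := by
  have hh := frub_hom v α m hm x
  have hS : ∀ z, 0 ≤ frubS δ z := fun z => Set.indicator_nonneg (by simp) z
  have hk : 0 ≤ m * δ ^ 2 / 3 := by positivity
  have hI : (Metric.ball (0 : EuclideanSpace ℝ (Fin 3)) 1).indicator (1 : EuclideanSpace ℝ (Fin 3) → ℝ) x ≤ 1 :=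
    Set.indicator_le_self' (by intros; exact zero_le_one) x
  by_cases hg : ∀ i, δ ≤ |⟪v i, x⟫|
  · have hs : 0 ≤ ∑ i, frubS δ ⟪v i, x⟫ := Finset.sum_nonneg fun i _ => hS _
    by_cases hx : x ∈ Metric.ball (0 : EuclideanSpace ℝ (Fin 3)) 1
    · have hx1 : ‖x‖ < 1 := by simpa using hx
      have hgood := frub_good v hv α m hm δ hδ x hg
      have : ‖x‖ + δ ^ 2 / 3 ≤ √(‖x‖ ^ 2 + δ ^ 2) := by
        apply Real.le_sqrt_of_sq_le
        have d1 : δ ^ 2 ≤ 1 := pow_le_one₀ hδ hδ1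
        have d2 : ‖x‖ * δ ^ 2 ≤ 1 * δ ^ 2 := by gcongr
        have d3 : δ ^ 2 * δ ^ 2 ≤ 1 * δ ^ 2 := by gcongr
        nlinarith [sq_nonneg δ]
      have := mul_le_mul_of_nonneg_left this hm0
      nlinarith
    · rw [Set.indicator_of_notMem hx]
      nlinarith
  · push Not at hg
    obtain ⟨i, hi⟩ := hg
    have h1 : frubS δ ⟪v i, x⟫ = 1 := by
      have : ⟪v i, x⟫ ∈ Set.Ioo (-δ) δ := abs_lt.1 hi
      simp [frubS, Set.indicator_of_mem this]
    have h2 : 1 ≤ ∑ i, frubS δ ⟪v i, x⟫ := by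
      rw [← h1]
      exact Finset.single_le_sum (f := fun i => frubS δ ⟪v i, x⟫) (fun i _ => hS _)
        (Finset.mem_univ i)
    nlinarith

theorem frub_slab1 (δ : ℝ) (hδ : 0 ≤ δ) : ∫ z : ℝ, frubS δ z * Real.exp (-z ^ 2) ≤ 2 * δ := by
  have : ∫ z : ℝ, frubS δ z = 2 * δ := by
    unfold frubS
    rw [integral_indicator_one measurableSet_Ioo, Real.volume_real_Ioo_of_le (by linarith)]
    ring
  rw [← this]
  apply integral_mono_of_nonneg
  · filter_upwards with z
    exact mul_nonneg (Set.indicator_nonneg (by simp) z) (Real.exp_pos _).le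
  · exact (integrable_indicator_iff measurableSet_Ioo).2 (by simp [integrableOn_const_iff, Pi.one_def])
  · filter_upwards with z
    exact mul_le_of_le_one_right (Set.indicator_nonneg (by simp) z)
      (Real.exp_le_one_iff.2 (by nlinarith))

theorem frub_intW : Integrable fun x : EuclideanSpace ℝ (Fin 3) => Real.exp (-‖x‖ ^ 2) := by
  apply Integrable.of_integral_ne_zero
  have h := frub_gauss (EuclideanSpace.single 0 1) (by simp) 1
  have hg : ∫ z : ℝ, Real.exp (-z ^ 2) = √Real.pi := by simpa using integral_gaussian 1
  simp only [Pi.one_apply, one_mul, hg] at h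
  rw [h]
  positivity

theorem frub_intS (v : EuclideanSpace ℝ (Fin 3)) (δ : ℝ) :
    Integrable fun x : EuclideanSpace ℝ (Fin 3) => frubS δ ⟪v, x⟫ * Real.exp (-‖x‖ ^ 2) := by
  have hm : Measurable (frubS δ) := measurable_one.indicator measurableSet_Ioo
  refine frub_intW.bdd_mul (c := 1) (Measurable.aestronglyMeasurable (by fun_prop)) ?_
  filter_upwards with x
  unfold frubS
  by_cases h : ⟪v, x⟫ ∈ Set.Ioo (-δ) δ
  · simp [Set.indicator_of_mem h]
  · simp [Set.indicator_of_notMem h]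

/-- Gaussian mass of the unit ball -/
noncomputable def frubW : ℝ := ∫ x : EuclideanSpace ℝ (Fin 3),
  (Metric.ball (0 : EuclideanSpace ℝ (Fin 3)) 1).indicator 1 x * Real.exp (-‖x‖ ^ 2)

theorem frub_intB : Integrable fun x : EuclideanSpace ℝ (Fin 3) =>
    (Metric.ball (0 : EuclideanSpace ℝ (Fin 3)) 1).indicator 1 x * Real.exp (-‖x‖ ^ 2) := by
  refine frub_intW.bdd_mul (c := 1)
    (measurable_one.indicator Metric.isOpen_ball.measurableSet).aestronglyMeasurable ?_
  filter_upwards with x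
  by_cases h : x ∈ Metric.ball (0 : EuclideanSpace ℝ (Fin 3)) 1
  · simp [Set.indicator_of_mem h]
  · simp [Set.indicator_of_notMem h]

theorem frubW_pos : 0 < frubW := by
  unfold frubW
  rw [integral_pos_iff_support_of_nonneg _ frub_intB]
  · refine lt_of_lt_of_le (Metric.measure_ball_pos volume (0 : EuclideanSpace ℝ (Fin 3)) one_pos)
      (measure_mono fun x hx => ?_)
    rw [Function.mem_support, Set.indicator_of_mem hx]
    simp [(Real.exp_pos _).ne']
  · intro x
    exact mul_nonneg (Set.indicator_nonneg (by simp) x) (Real.exp_pos _).le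

theorem frub_main {n : ℕ} (v : Fin n → EuclideanSpace ℝ (Fin 3)) (hv : ∀ i, ‖v i‖ = 1)
    (α : Fin n → ℝ) (hα : ∑ i, α i = 1) (m : ℝ) (hm0 : 0 ≤ m)
    (hm : ∀ c : EuclideanSpace ℝ (Fin 3), ‖c‖ = 1 → m ≤ ∑ i, α i * |⟪v i, c⟫|)
    (δ : ℝ) (hδ : 0 ≤ δ) (hδ1 : δ ≤ 1) :
    m * (2 * Real.pi) + m * δ ^ 2 / 3 * (frubW - n * (2 * δ * Real.pi)) ≤ Real.pi := by
  have hA : ∀ i, ∫ x : EuclideanSpace ℝ (Fin 3), |⟪v i, x⟫| * Real.exp (-‖x‖ ^ 2) = Real.pi :=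
    fun i => by rw [frub_gauss (v i) (hv i) (fun z => |z|), frub_abs1, one_mul]
  have iA : ∀ i, Integrable fun x : EuclideanSpace ℝ (Fin 3) =>
      |⟪v i, x⟫| * Real.exp (-‖x‖ ^ 2) := fun i =>
    Integrable.of_integral_ne_zero (by rw [hA i]; exact Real.pi_ne_zero)
  have iN : Integrable fun x : EuclideanSpace ℝ (Fin 3) => ‖x‖ * Real.exp (-‖x‖ ^ 2) :=
    Integrable.of_integral_ne_zero (by rw [frub_norm]; positivity)
  have iR : Integrable fun x : EuclideanSpace ℝ (Fin 3) =>
      ∑ i, α i * (|⟪v i, x⟫| * Real.exp (-‖x‖ ^ 2)) :=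
    integrable_finsetSum _ fun i _ => (iA i).const_mul _
  have iS : Integrable fun x : EuclideanSpace ℝ (Fin 3) =>
      ∑ i, frubS δ ⟪v i, x⟫ * Real.exp (-‖x‖ ^ 2) :=
    integrable_finsetSum _ fun i _ => frub_intS (v i) δ
  have iD : Integrable fun x : EuclideanSpace ℝ (Fin 3) => m * δ ^ 2 / 3 *
      ((Metric.ball (0 : EuclideanSpace ℝ (Fin 3)) 1).indicator 1 x * Real.exp (-‖x‖ ^ 2)
        - ∑ i, frubS δ ⟪v i, x⟫ * Real.exp (-‖x‖ ^ 2)) := (frub_intB.sub iS).const_mul _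
  have key : ∫ x : EuclideanSpace ℝ (Fin 3), (m * (‖x‖ * Real.exp (-‖x‖ ^ 2)) + m * δ ^ 2 / 3 *
      ((Metric.ball (0 : EuclideanSpace ℝ (Fin 3)) 1).indicator 1 x * Real.exp (-‖x‖ ^ 2)
        - ∑ i, frubS δ ⟪v i, x⟫ * Real.exp (-‖x‖ ^ 2)))
      ≤ ∫ x : EuclideanSpace ℝ (Fin 3), ∑ i, α i * (|⟪v i, x⟫| * Real.exp (-‖x‖ ^ 2)) := by
    refine integral_mono ((iN.const_mul _).add iD) iR fun x => ?_
    have h := mul_le_mul_of_nonneg_right (frub_pointwise v hv α m hm0 hm δ hδ hδ1 x)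
      (Real.exp_pos (-‖x‖ ^ 2)).le
    simp only [← Finset.sum_mul, ← mul_assoc] at h ⊢
    refine le_trans (le_of_eq ?_) h
    ring
  rw [integral_add (iN.const_mul _) iD, integral_const_mul,
    integral_const_mul, integral_sub frub_intB iS, frub_norm,
    integral_finsetSum _ (fun i _ => frub_intS (v i) δ),
    integral_finsetSum _ (fun i _ => (iA i).const_mul _)] at key
  simp only [integral_const_mul, hA, ← Finset.sum_mul, hα, one_mul] at key
  refine le_trans ?_ key
  have hb : ∑ i, ∫ x : EuclideanSpace ℝ (Fin 3), frubS δ ⟪v i, x⟫ * Real.exp (-‖x‖ ^ 2)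
      ≤ n * (2 * δ * Real.pi) := by
    calc _ ≤ ∑ i : Fin n, 2 * δ * Real.pi := by
          refine Finset.sum_le_sum fun i _ => ?_
          rw [frub_gauss (v i) (hv i) (frubS δ)]
          exact mul_le_mul_of_nonneg_right (frub_slab1 δ hδ) Real.pi_pos.le
      _ = _ := by simp
  have hk : 0 ≤ m * δ ^ 2 / 3 := by positivity
  change _ ≤ m * (2 * Real.pi) + m * δ ^ 2 / 3 * (frubW - _)
  gcongr

/-- Upper bound `R(n) ≤ 1/2 − c·n^(−5/2)` on the `n`-outcome compatibility radius for
the full Bloch sphere: there is a constant `c > 0` such that for any `n ≥ 1` unit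
vectors in `ℝ³` and weights summing to 1, some unit vector `c'` satisfies
`Σᵢ αᵢ|⟨nᵢ, c'⟩| ≤ 1/2 − c·n^(−5/2)`. -/
theorem full_radius_upper_bound :
    ∃ c : ℝ, 0 < c ∧ ∀ n : ℕ, 1 ≤ n →
      ∀ v : Fin n → EuclideanSpace ℝ (Fin 3), (∀ i, ‖v i‖ = 1) →
      ∀ α : Fin n → ℝ, (∀ i, 0 ≤ α i) → ∑ i, α i = 1 →
      ∃ c' : EuclideanSpace ℝ (Fin 3), ‖c'‖ = 1 ∧
        ∑ i, α i * |⟪v i, c'⟫| ≤ 1 / 2 - c * (n : ℝ) ^ (-(5 / 2 : ℝ)) := by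
  have hW := frubW_pos
  have hpi := Real.pi_pos
  obtain ⟨κ, hκ, hκ1, hκW⟩ : ∃ κ : ℝ, 0 < κ ∧ κ ≤ 1 ∧ 2 * κ * Real.pi ≤ frubW / 2 := by
    refine ⟨min 1 (frubW / (4 * Real.pi)), by positivity, min_le_left _ _, ?_⟩
    have h := min_le_right 1 (frubW / (4 * Real.pi))
    rw [le_div_iff₀ (by positivity)] at h
    linarith
  obtain ⟨c, hc, hc1, hc2⟩ : ∃ c : ℝ, 0 < c ∧ c ≤ 1 / 4 ∧
      2 * Real.pi * c < κ ^ 2 * frubW / 24 := by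
    refine ⟨min (1 / 4) (κ ^ 2 * frubW / (96 * Real.pi)), by positivity, min_le_left _ _, ?_⟩
    have h := min_le_right (1 / 4) (κ ^ 2 * frubW / (96 * Real.pi))
    rw [le_div_iff₀ (by positivity)] at h
    have : 0 < κ ^ 2 * frubW := by positivity
    linarith
  refine ⟨c, hc, fun n hn v hv α _ hα => ?_⟩
  by_contra! hcon
  have hn1 : (1 : ℝ) ≤ n := by exact_mod_cast hn
  have hn0 : (0 : ℝ) < n := by linarith
  set p : ℝ := (n : ℝ) ^ (-(5 / 2 : ℝ)) with hp
  have hp2 : p ≤ ((n : ℝ) ^ 2)⁻¹ := by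
    rw [← Real.rpow_natCast, ← Real.rpow_neg hn0.le]
    exact Real.rpow_le_rpow_of_exponent_le hn1 (by norm_num)
  have hq1 : ((n : ℝ) ^ 2)⁻¹ ≤ 1 := inv_le_one_of_one_le₀ (one_le_pow₀ hn1)
  have hq0 : 0 < ((n : ℝ) ^ 2)⁻¹ := by positivity
  have hp0 : 0 < p := Real.rpow_pos_of_pos hn0 _
  have hm4 : 1 / 4 ≤ 1 / 2 - c * p := by nlinarith
  have h := frub_main v hv α hα (1 / 2 - c * p) (by linarith) (fun x hx => (hcon x hx).le)
    (κ / n) (by positivity) ((div_le_one hn0).2 (by linarith))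
  have e1 : (n : ℝ) * (2 * (κ / n) * Real.pi) = 2 * κ * Real.pi := by field_simp
  have e2 : (κ / n) ^ 2 = κ ^ 2 * ((n : ℝ) ^ 2)⁻¹ := by rw [div_pow, div_eq_mul_inv]
  rw [e1, e2] at h
  generalize ((n : ℝ) ^ 2)⁻¹ = q at *
  have h1 : (1 / 4) * (κ ^ 2 * q) / 3 * (frubW / 2) ≤
      (1 / 2 - c * p) * (κ ^ 2 * q) / 3 * (frubW - 2 * κ * Real.pi) := by
    have : frubW / 2 ≤ frubW - 2 * κ * Real.pi := by linarith
    gcongr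
  have h2 : 2 * Real.pi * c * p ≤ 2 * Real.pi * c * q := by gcongr
  have h3 := mul_lt_mul_of_pos_right hc2 hq0
  linarith
end

section
/- There exists a constant c > 0 such that for every n ≥ 1, every family of unit vectors n₁,…,n_n in ℝ², and every weights α₁,…,α_n ≥ 0 with Σᵢ αᵢ = 1, there exists a unit vector c' ∈ ℝ² with Σᵢ αᵢ·|⟨nᵢ, c'⟩| ≤ 2/π − c·n^{−4}. (Upper bound R^p(n) ≤ 2/π − c·n^{−4} on the planar n-outcome compatibility radius.) -/
open Real
open scoped RealInnerProductSpace

lemma aux_int_abs_cos (a p : ℝ) : ∫ t in a..(a+π), |cos (t - p)| = 2 := by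
  have hper : Function.Periodic (fun t : ℝ => |cos (t - p)|) π := by
    intro t
    have : t + π - p = (t - p) + π := by ring
    simp only [this, cos_add_pi, abs_neg]
  rw [hper.intervalIntegral_add_eq a (p - π/2)]
  have h1 : p - π/2 + π = p + π/2 := by ring
  rw [h1, intervalIntegral.integral_comp_sub_right (fun t => |cos t|) p]
  have h2 : p - π/2 - p = -(π/2) := by ring
  have h3 : p + π/2 - p = π/2 := by ring
  rw [h2, h3]
  have : ∫ t in (-(π/2))..(π/2), |cos t| = ∫ t in (-(π/2))..(π/2), cos t := by
    apply intervalIntegral.integral_congr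
    intro t ht
    rw [Set.uIcc_of_le (by linarith [pi_pos])] at ht
    exact abs_of_nonneg (cos_nonneg_of_mem_Icc ht)
  rw [this, integral_cos]
  simp
  norm_num

lemma aux_sin_lower (n k : ℕ) (hk : 1 ≤ k) (hkn : k ≤ n) :
    2 / ((n:ℝ) + 1) ≤ sin (k * π / (n + 1)) := by
  have hn : (0:ℝ) < (n:ℝ) + 1 := by positivity
  have hk' : (1:ℝ) ≤ k := by exact_mod_cast hk
  have hkn' : (k:ℝ) ≤ n := by exact_mod_cast hkn
  by_cases h : (k * π / (n + 1) : ℝ) ≤ π / 2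
  · have := mul_le_sin (x := k * π / (n + 1)) (by positivity) h
    refine le_trans ?_ this
    have e : 2 / π * (k * π / ((n:ℝ) + 1)) = 2 * k / (n + 1) := by
      field_simp
    rw [e]
    gcongr
    linarith
  · push Not at h
    rw [← sin_pi_sub]
    have e0 : π - k * π / ((n:ℝ) + 1) = (n + 1 - k) * π / (n + 1) := by
      field_simp
    have := mul_le_sin (x := π - k * π / ((n:ℝ) + 1)) (by
      rw [e0]
      have : (0:ℝ) ≤ n + 1 - k := by linarith
      positivity) (by linarith)
    refine le_trans ?_ this
    have e : 2 / π * (π - k * π / ((n:ℝ) + 1)) = 2 * (n + 1 - k) / (n + 1) := by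
      field_simp
    rw [e]
    gcongr
    linarith

lemma aux_sin_diff (a b s : ℝ) (ha : |cos a| < s) (hb : |cos b| < s) :
    sin (a - b) < 2 * s := by
  rw [sin_sub]
  have h1 : sin a * cos b ≤ |cos b| := by
    calc _ ≤ |sin a * cos b| := le_abs_self _
      _ = |sin a| * |cos b| := abs_mul _ _
      _ ≤ 1 * |cos b| := by gcongr; exact abs_sin_le_one a
      _ = _ := one_mul _
  have h2 : -(cos a * sin b) ≤ |cos a| := by
    calc _ ≤ |cos a * sin b| := neg_le_abs _
      _ = |cos a| * |sin b| := abs_mul _ _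
      _ ≤ |cos a| * 1 := by gcongr; exact abs_sin_le_one b
      _ = _ := mul_one _
  linarith

lemma aux_pigeon (n : ℕ) (p : Fin n → ℝ) :
    ∃ m : ℝ, ∀ i, 1 / ((n:ℝ) + 1) ≤ |cos (m - p i)| := by
  by_contra! hcon
  choose g hg using fun j : Fin (n+1) => hcon ((j:ℕ) * π / (n + 1))
  obtain ⟨j, k, hjk, he⟩ := Fintype.exists_ne_map_eq_of_card_lt g (by simp)
  have key : ∀ j k : Fin (n+1), j < k → g j = g k → False := by
    intro j k hlt he
    have h1 := hg j
    have h2 := hg k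
    rw [he] at h1
    have h3 := aux_sin_diff _ _ _ h2 h1
    have hlt' : (j:ℕ) < k := hlt
    have h4 := aux_sin_lower n ((k:ℕ) - j) (by omega) (by omega)
    rw [Nat.cast_sub hlt'.le] at h4
    have e : ((k:ℕ):ℝ) * π / (n + 1) - p (g k) - (((j:ℕ):ℝ) * π / (n + 1) - p (g k))
      = (((k:ℕ):ℝ) - ((j:ℕ):ℝ)) * π / (n + 1) := by ring
    rw [e] at h3
    have e2 : 2 * (1 / ((n:ℝ)+1)) = 2 / ((n:ℝ)+1) := by ring
    linarith
  rcases lt_or_gt_of_ne hjk with h | h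
  · exact key _ _ h he
  · exact key _ _ h he.symm

lemma aux_local (x s : ℝ) (hx : s ≤ |cos x|) :
    ∃ B : ℝ, ∀ t, |t| ≤ s → |cos (x + t)| = |cos x| * cos t + B * sin t := by
  have lip : ∀ t, |cos (x + t) - cos x| ≤ |t| := by
    intro t
    have := abs_cos_sub_cos_le (x+t) x
    simpa using this
  rcases le_total 0 (cos x) with h | h
  · refine ⟨-sin x, fun t ht => ?_⟩
    rw [abs_of_nonneg h] at hx ⊢
    have := (abs_le.1 ((lip t).trans ht)).1
    rw [abs_of_nonneg (by linarith), cos_add]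
    ring
  · refine ⟨sin x, fun t ht => ?_⟩
    rw [abs_of_nonpos h] at hx ⊢
    have := (abs_le.1 ((lip t).trans ht)).2
    rw [abs_of_nonpos (by linarith), cos_add]
    ring

lemma aux_tan (s : ℝ) (h0 : 0 < s) (h1 : s ≤ 1/2) :
    (s + s^3/8) * cos s ≤ sin s := by
  have hs := sin_gt_sub_cube h0
  have hc := (abs_le.1 (cos_bound (x := s) (by rw [abs_of_pos h0]; linarith))).2
  rw [abs_of_pos h0] at hc
  have hc' : cos s ≤ 1 - s^2/2 + s^4 * (5/96) := by linarith
  have h3 : (s + s^3/8) * cos s ≤ (s + s^3/8) * (1 - s^2/2 + s^4 * (5/96)) := by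
    gcongr
  have h2 : s^2 ≤ 1/4 := by nlinarith
  have h5 : 0 < s^3 := by positivity
  have h6 : s^3 * s^2 ≤ s^3 * (1/4) := by gcongr
  have h7 : s^3 * s^4 ≤ s^3 * (1/16) := by
    gcongr
    nlinarith [sq_nonneg s]
  nlinarith

lemma aux_main (n : ℕ) (hn : 1 ≤ n) (p α : Fin n → ℝ) (hsum : ∑ i, α i = 1) (r : ℝ)
    (hr : ∀ θ, r ≤ ∑ i, α i * |cos (θ - p i)|) :
    r * (π + (1/((n:ℝ)+1))^3 / 4) ≤ 2 := by
  obtain ⟨m, hm⟩ := aux_pigeon n p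
  set s : ℝ := 1/((n:ℝ)+1) with hs
  have hn' : (1:ℝ) ≤ n := by exact_mod_cast hn
  have s0 : 0 < s := by positivity
  have s1 : s ≤ 1/2 := by
    rw [hs]
    exact one_div_le_one_div_of_le (by norm_num) (by linarith)
  choose B hB using fun i => aux_local (m - p i) s (hm i)
  set f : ℝ → ℝ := fun θ => ∑ i, α i * |cos (θ - p i)| with hf
  have fc : Continuous f := by fun_prop
  have fi : ∀ a b, IntervalIntegrable f MeasureTheory.volume a b :=
    fun a b => fc.intervalIntegrable a b
  have hloc : ∀ t, |t| ≤ s → f (m + t) = f m * cos t + (∑ i, α i * B i) * sin t := by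
    intro t ht
    simp only [hf, Finset.sum_mul, ← Finset.sum_add_distrib]
    refine Finset.sum_congr rfl fun i _ => ?_
    have e : m + t - p i = m - p i + t := by ring
    rw [e, hB i t ht]
    ring
  have htot : ∫ t in (m - s)..(m - s + π), f t = 2 := by
    simp only [hf]
    rw [intervalIntegral.integral_finsetSum]
    · simp only [intervalIntegral.integral_const_mul, aux_int_abs_cos]
      rw [← Finset.sum_mul, hsum, one_mul]
    · intro i _
      exact Continuous.intervalIntegrable (by fun_prop) _ _
  have hcen : ∫ t in (m - s)..(m + s), f t = 2 * sin s * f m := by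
    have e : ∫ t in (-s)..s, f (m + t) = ∫ t in (m - s)..(m + s), f t := by
      rw [intervalIntegral.integral_comp_add_left f m]
      rfl
    rw [← e]
    have : ∫ t in (-s)..s, f (m + t)
        = ∫ t in (-s)..s, (f m * cos t + (∑ i, α i * B i) * sin t) := by
      apply intervalIntegral.integral_congr
      intro t ht
      rw [Set.uIcc_of_le (by linarith)] at ht
      exact hloc t (abs_le.2 ht)
    rw [this, intervalIntegral.integral_add
      (Continuous.intervalIntegrable (by fun_prop) _ _)
      (Continuous.intervalIntegrable (by fun_prop) _ _),
      intervalIntegral.integral_const_mul, intervalIntegral.integral_const_mul,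
      integral_cos, integral_sin]
    simp
    ring
  have hrest : r * (π - 2 * s) ≤ ∫ t in (m + s)..(m - s + π), f t := by
    have := intervalIntegral.integral_mono_on (a := m + s) (b := m - s + π)
      (f := fun _ => r) (g := f) (by linarith [pi_gt_three]) (by simp) (fi _ _)
      (fun x _ => hr x)
    rw [intervalIntegral.integral_const, smul_eq_mul] at this
    linarith
  have hsplit := intervalIntegral.integral_add_adjacent_intervals
    (fi (m - s) (m + s)) (fi (m + s) (m - s + π))
  have hF : r ≤ f m * cos s := by
    have a1 := hloc s (by rw [abs_of_pos s0])
    have a2 := hloc (-s) (by rw [abs_neg, abs_of_pos s0])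
    rw [cos_neg, sin_neg] at a2
    have b1 := hr (m + s)
    have b2 := hr (m + -s)
    change r ≤ f (m + s) at b1
    change r ≤ f (m + -s) at b2
    linarith
  have ht := aux_tan s s0 s1
  have hcpos : 0 < cos s := cos_pos_of_mem_Ioo ⟨by linarith [pi_gt_three], by linarith [pi_gt_three]⟩
  rcases le_or_gt r 0 with h | h
  · have : r * (π + s^3/4) ≤ 0 := mul_nonpos_of_nonpos_of_nonneg h (by positivity)
    linarith
  · have hfm : 0 < f m := by
      by_contra! hc
      nlinarith
    have h1 : (s + s^3/8) * cos s * f m ≤ sin s * f m := by gcongr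
    have h2 : (s + s^3/8) * r ≤ (s + s^3/8) * (f m * cos s) := by gcongr
    nlinarith

lemma aux_angle_s8 (v : EuclideanSpace ℝ (Fin 2)) (hv : ‖v‖ = 1) :
    ∃ p : ℝ, ∀ θ : ℝ, ⟪v, !₂[cos θ, sin θ]⟫ = cos (θ - p) := by
  have h : v 0 ^ 2 + v 1 ^ 2 = 1 := by
    have := EuclideanSpace.real_norm_sq_eq v
    rw [hv, Fin.sum_univ_two] at this
    linarith
  set z : ℂ := ⟨v 0, v 1⟩ with hz
  have hn : ‖z‖ = 1 := by
    rw [Complex.norm_eq_sqrt_sq_add_sq]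
    simp [hz, h]
  refine ⟨z.arg, fun θ => ?_⟩
  have h1 := Complex.norm_mul_cos_arg z
  have h2 := Complex.norm_mul_sin_arg z
  rw [hn, one_mul] at h1 h2
  rw [cos_sub, h1, h2]
  simp [PiLp.inner_apply, Fin.sum_univ_two, hz]

/-- Upper bound `R^p(n) ≤ 2/π − c·n^(−4)` on the planar `n`-outcome compatibility
radius: there is a constant `c > 0` such that for any `n ≥ 1` unit vectors in `ℝ²` and
weights summing to 1, some unit vector `c'` satisfies
`Σᵢ αᵢ|⟨nᵢ, c'⟩| ≤ 2/π − c·n^(−4)`. -/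
theorem planar_radius_upper_bound :
    ∃ c : ℝ, 0 < c ∧ ∀ n : ℕ, 1 ≤ n →
      ∀ v : Fin n → EuclideanSpace ℝ (Fin 2), (∀ i, ‖v i‖ = 1) →
      ∀ α : Fin n → ℝ, (∀ i, 0 ≤ α i) → ∑ i, α i = 1 →
      ∃ c' : EuclideanSpace ℝ (Fin 2), ‖c'‖ = 1 ∧
        ∑ i, α i * |⟪v i, c'⟫| ≤ 2 / π - c * (n : ℝ) ^ (-(4 : ℝ)) := by
  refine ⟨1/1000, by norm_num, fun n hn v hv α _ hsum => ?_⟩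
  by_contra! hcon
  choose p hp using fun i => aux_angle_s8 (v i) (hv i)
  have hmain := aux_main n hn p α hsum (2 / π - 1/1000 * (n : ℝ) ^ (-(4 : ℝ))) (by
    intro θ
    have := hcon !₂[cos θ, sin θ] (by
      rw [EuclideanSpace.norm_eq, Fin.sum_univ_two]
      simp)
    simp only [hp] at this
    exact this.le)
  have hn' : (1:ℝ) ≤ n := by exact_mod_cast hn
  have hpow : (n : ℝ) ^ (-(4 : ℝ)) = 1 / (n:ℝ)^4 := by
    rw [rpow_neg (by positivity), one_div]
    norm_cast
  have hd : 1 / (n:ℝ)^4 ≤ 1 / (n:ℝ)^3 :=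
    one_div_le_one_div_of_le (by positivity) (pow_le_pow_right₀ hn' (by norm_num))
  have hs : 1/8 * (1 / (n:ℝ)^3) ≤ (1/((n:ℝ)+1))^3 := by
    have : 1 / (2 * (n:ℝ)) ≤ 1/((n:ℝ)+1) :=
      one_div_le_one_div_of_le (by positivity) (by linarith)
    calc 1/8 * (1 / (n:ℝ)^3) = (1 / (2 * (n:ℝ)))^3 := by field_simp; norm_num
      _ ≤ _ := by gcongr
  have hs1 : (1/((n:ℝ)+1))^3 ≤ 1 := by
    apply pow_le_one₀ (by positivity)
    rw [div_le_one (by positivity)]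
    linarith
  have hdpos : 0 < 1 / (n:ℝ)^4 := by positivity
  have hd3 : 0 < 1 / (n:ℝ)^3 := by positivity
  rw [hpow] at hmain
  generalize (1/((n:ℝ)+1))^3 = S at *
  generalize 1 / (n:ℝ)^4 = D at *
  generalize 1 / (n:ℝ)^3 = T at *
  have e : (2 / π - 1/1000 * D) * (π + S/4)
      = 2 + (1/π) * (S/2) - 1/1000 * D * (π + S/4) := by
    field_simp
    ring
  rw [e] at hmain
  have hpi : 1/4 ≤ 1/π := one_div_le_one_div_of_le pi_pos pi_le_four
  have h1 : 1/4 * (S/2) ≤ (1/π) * (S/2) := by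
    apply mul_le_mul_of_nonneg_right hpi
    linarith
  have h2 : D * (π + S/4) ≤ D * 5 := by
    apply mul_le_mul_of_nonneg_left _ hdpos.le
    linarith [pi_le_four]
  linarith
end
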